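/- Let n ≥ 1, let T > 0, let C > 0, and let f : ℝ × ℝⁿ → ℝ be a function such that |f(t,x₁) − f(t,x₂)| ≤ C‖x₁ − x₂‖ for all t ∈ [0,T] and all x₁, x₂ ∈ ℝⁿ. Define F(t,y,z) := f(t,z) − C⟨y,z⟩ for y, z ∈ ℝⁿ. Then for every t ∈ [0,T] and every x ∈ ℝⁿ, f(t,x) = max over z ∈ ℝⁿ of ( min over y in the closed unit ball of ℝⁿ of ( C⟨y,x⟩ + F(t,y,z) ) ); more precisely, for every z ∈ ℝⁿ the inner infimum over y in the closed unit ball of C⟨y,x⟩ + F(t,y,z) is attained, and f(t,x) is the greatest element of the set { inf_{‖y‖≤1} ( C⟨y,x⟩ + F(t,y,z) ) : z ∈ ℝⁿ }. -/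

import Mathlib

open scoped RealInnerProductSpace

/-- Lemma 2.1 (Evans–Souganidis min-max representation): if `f(t, ·)` is
`C`-Lipschitz on `[0,T]`, and `F(t,y,z) := f(t,z) - C⟪y,z⟫`, then for every
`t ∈ [0,T]` and `x`, the inner infimum over the closed unit ball of
`C⟪y,x⟫ + F(t,y,z)` is attained for each `z`, and
`f(t,x) = max_{z} min_{‖y‖ ≤ 1} ( C⟪y,x⟫ + F(t,y,z) )`, the outer maximum being
the greatest element of the set of inner infima. -/
theorem lipschitz_minmax_representation (n : ℕ) (hn : 1 ≤ n) (T : ℝ) (hT : 0 < T)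
    (C : ℝ) (hC : 0 < C) (f : ℝ × EuclideanSpace ℝ (Fin n) → ℝ)
    (hf : ∀ t ∈ Set.Icc (0 : ℝ) T, ∀ x₁ x₂ : EuclideanSpace ℝ (Fin n),
      |f (t, x₁) - f (t, x₂)| ≤ C * ‖x₁ - x₂‖)
    (F : ℝ → EuclideanSpace ℝ (Fin n) → EuclideanSpace ℝ (Fin n) → ℝ)
    (hF : ∀ (t : ℝ) (y z : EuclideanSpace ℝ (Fin n)),
      F t y z = f (t, z) - C * ⟪y, z⟫)
    (t : ℝ) (ht : t ∈ Set.Icc (0 : ℝ) T) (x : EuclideanSpace ℝ (Fin n)) :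
    (∀ z : EuclideanSpace ℝ (Fin n), ∃ y₀ : EuclideanSpace ℝ (Fin n),
      ‖y₀‖ ≤ 1 ∧
      IsLeast {v : ℝ | ∃ y : EuclideanSpace ℝ (Fin n), ‖y‖ ≤ 1 ∧
        v = C * ⟪y, x⟫ + F t y z} (C * ⟪y₀, x⟫ + F t y₀ z)) ∧
    IsGreatest
      {w : ℝ | ∃ z : EuclideanSpace ℝ (Fin n),
        w = sInf {v : ℝ | ∃ y : EuclideanSpace ℝ (Fin n), ‖y‖ ≤ 1 ∧
          v = C * ⟪y, x⟫ + F t y z}}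
      (f (t, x)) := by
  have hval : ∀ y z : EuclideanSpace ℝ (Fin n),
      C * ⟪y, x⟫ + F t y z = f (t, z) + C * ⟪y, x - z⟫ := by
    intro y z
    rw [hF, inner_sub_right]
    ring
  have hlow : ∀ y z : EuclideanSpace ℝ (Fin n), ‖y‖ ≤ 1 →
      f (t, z) - C * ‖x - z‖ ≤ C * ⟪y, x⟫ + F t y z := by
    intro y z hy
    rw [hval]
    have h1 := (abs_le.mp (abs_real_inner_le_norm y (x - z))).1
    have h2 : ‖y‖ * ‖x - z‖ ≤ ‖x - z‖ := mul_le_of_le_one_left (norm_nonneg _) hy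
    have h3 : -‖x - z‖ ≤ ⟪y, x - z⟫ := by linarith
    have h4 := mul_le_mul_of_nonneg_left h3 hC.le
    linarith
  have hex : ∀ z : EuclideanSpace ℝ (Fin n), ∃ y : EuclideanSpace ℝ (Fin n),
      ‖y‖ ≤ 1 ∧ C * ⟪y, x⟫ + F t y z = f (t, z) - C * ‖x - z‖ := by
    intro z
    refine ⟨-(‖x - z‖⁻¹ • (x - z)), ?_, ?_⟩
    · rw [norm_neg, norm_smul, norm_inv, norm_norm]
      exact inv_mul_le_one
    · rw [hval, inner_neg_left, real_inner_smul_left, real_inner_self_eq_norm_sq]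
      by_cases h : ‖x - z‖ = 0
      · simp [h]
      · field_simp
        ring
  have hleast : ∀ z : EuclideanSpace ℝ (Fin n),
      IsLeast {v : ℝ | ∃ y : EuclideanSpace ℝ (Fin n), ‖y‖ ≤ 1 ∧
        v = C * ⟪y, x⟫ + F t y z} (f (t, z) - C * ‖x - z‖) := by
    intro z
    obtain ⟨y, hy, h⟩ := hex z
    refine ⟨⟨y, hy, h.symm⟩, ?_⟩
    rintro v ⟨y', hy', rfl⟩
    exact hlow y' z hy'
  refine ⟨fun z => ?_, ⟨x, ?_⟩, ?_⟩
  · obtain ⟨y, hy, h⟩ := hex z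
    exact ⟨y, hy, h ▸ hleast z⟩
  · rw [(hleast x).csInf_eq]
    simp
  · rintro w ⟨z, rfl⟩
    rw [(hleast z).csInf_eq]
    have h := (abs_le.mp (hf t ht x z)).1
    linarith
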